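/- Let σ : 𝒢 → 𝒜 be an assignment with V_i := Σ_{j∈σ⁻¹(i)} v_{ij} > 0 for every agent i. Define b_{ij} = v_{ij}/V_i if σ(j) = i and b_{ij} = 0 otherwise. Then b ∈ P(𝒜,𝒢) and f_cvx(b) = f_ncvx(b) = NSW(σ). Consequently both CVX-Weighted and NCVX-Weighted are relaxations: sup_{b∈P(𝒜,𝒢)} f_cvx(b) ≥ OPT and sup_{b∈P(𝒜,𝒢)} f_ncvx(b) ≥ OPT. -/

import Mathlib

open Finset

/-- The feasibility polytope `P(𝒜,𝒢)`. -/
def Feasible {A G : Type*} [Fintype A] [Fintype G] (b : A → G → ℝ) : Prop :=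
  (∀ i j, 0 ≤ b i j) ∧ (∀ i, ∑ j, b i j = 1) ∧ (∀ j, ∑ i, b i j ≤ 1)

/-- Weighted Nash Social Welfare (log objective) of an assignment `σ : 𝒢 → 𝒜`. -/
noncomputable def NSW {A G : Type*} [Fintype A] [Fintype G] [DecidableEq A]
    (v : A → G → ℝ) (w : A → ℝ) (σ : G → A) : ℝ :=
  ∑ i, w i * Real.log (∑ j ∈ Finset.univ.filter (fun j => σ j = i), v i j)

/-- The objective of the convex program CVX-Weighted. -/
noncomputable def fcvx {A G : Type*} [Fintype A] [Fintype G]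
    (v : A → G → ℝ) (w : A → ℝ) (b : A → G → ℝ) : ℝ :=
  (∑ i, ∑ j, w i * b i j * Real.log (v i j))
    - ∑ j, (∑ i, w i * b i j) * Real.log (∑ i, w i * b i j)
    + ∑ i, w i * Real.log (w i)

/-- The objective of the (non-convex) program NCVX-Weighted. -/
noncomputable def fncvx {A G : Type*} [Fintype A] [Fintype G]
    (v : A → G → ℝ) (w : A → ℝ) (b : A → G → ℝ) : ℝ :=
  (∑ i, ∑ j, w i * b i j * Real.log (v i j))
    - ∑ i, ∑ j, w i * b i j * Real.log (∑ i', b i' j)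

/-- The fractional point associated with an assignment `σ`:
`b_{ij} = v_{ij} / V_i` if `σ(j) = i` and `b_{ij} = 0` otherwise. -/
noncomputable def assignB {A G : Type*} [Fintype G] [DecidableEq A]
    (v : A → G → ℝ) (σ : G → A) : A → G → ℝ :=
  fun i j =>
    if σ j = i then v i j / (∑ j' ∈ Finset.univ.filter (fun j' => σ j' = i), v i j') else 0

/-- In column `j` of `assignB v σ` only the entry of the agent `σ j` can be nonzero. -/
lemma sum_mul_assignB_column {A G : Type*} [Fintype A] [Fintype G] [DecidableEq A]
    (v : A → G → ℝ) (σ : G → A) (c : A → ℝ) (j : G) :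
    ∑ i, c i * assignB v σ i j = c (σ j) * assignB v σ (σ j) j :=
  Finset.sum_eq_single _ (fun i _ hi => by simp [assignB, hi.symm]) (by simp)

lemma sum_assignB_column {A G : Type*} [Fintype A] [Fintype G] [DecidableEq A]
    (v : A → G → ℝ) (σ : G → A) (j : G) :
    ∑ i, assignB v σ i j = assignB v σ (σ j) j := by
  simpa using sum_mul_assignB_column v σ (fun _ => 1) j

lemma sum_assignB_row {A G : Type*} [Fintype G] [DecidableEq A]
    (v : A → G → ℝ) (σ : G → A) (i : A)
    (hσ : 0 < ∑ j ∈ Finset.univ.filter (fun j => σ j = i), v i j) :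
    ∑ j, assignB v σ i j = 1 := by
  simp only [assignB]
  rw [← Finset.sum_filter, ← Finset.sum_div, div_self hσ.ne']

lemma assignB_feasible {A G : Type*} [Fintype A] [Fintype G] [DecidableEq A]
    (v : A → G → ℝ) (hv : ∀ i j, 0 ≤ v i j) (σ : G → A)
    (hσ : ∀ i, 0 < ∑ j ∈ Finset.univ.filter (fun j => σ j = i), v i j) :
    Feasible (assignB v σ) := by
  have nonneg : ∀ i j, 0 ≤ assignB v σ i j := by
    intro i j
    unfold assignB
    split_ifs
    · exact div_nonneg (hv i j) (hσ i).le
    · exact le_rfl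
  refine ⟨nonneg, fun i => sum_assignB_row v σ i (hσ i), fun j => ?_⟩
  rw [sum_assignB_column, ← sum_assignB_row v σ (σ j) (hσ (σ j))]
  exact Finset.single_le_sum (fun k _ => nonneg (σ j) k) (Finset.mem_univ j)

lemma fncvx_assignB {A G : Type*} [Fintype A] [Fintype G] [DecidableEq A]
    (v : A → G → ℝ) (w : A → ℝ) (σ : G → A)
    (hσ : ∀ i, 0 < ∑ j ∈ Finset.univ.filter (fun j => σ j = i), v i j) :
    fncvx v w (assignB v σ) = NSW v w σ := by
  unfold fncvx NSW
  rw [← Finset.sum_sub_distrib]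
  refine Finset.sum_congr rfl fun i _ => ?_
  set V := ∑ j ∈ Finset.univ.filter (fun j => σ j = i), v i j with hV
  have hVpos : 0 < V := hσ i
  have entry : ∀ j, w i * assignB v σ i j * Real.log (v i j)
      - w i * assignB v σ i j * Real.log (∑ i', assignB v σ i' j)
      = w i * Real.log V * assignB v σ i j := by
    intro j
    rw [sum_assignB_column]
    by_cases hj : σ j = i
    · rw [hj]
      have hb : assignB v σ i j = v i j / V := by simp [assignB, hj, hV]
      rw [hb]
      by_cases h0 : v i j = 0
      · simp [h0]
      · rw [Real.log_div h0 hVpos.ne']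
        ring
    · simp [assignB, hj]
  rw [← Finset.sum_sub_distrib, Finset.sum_congr rfl fun j _ => entry j, ← Finset.mul_sum,
    sum_assignB_row v σ i (hσ i), mul_one]

lemma fcvx_assignB {A G : Type*} [Fintype A] [Fintype G] [DecidableEq A]
    (v : A → G → ℝ) (w : A → ℝ) (hw : ∀ i, 0 < w i) (σ : G → A)
    (hσ : ∀ i, 0 < ∑ j ∈ Finset.univ.filter (fun j => σ j = i), v i j) :
    fcvx v w (assignB v σ) = fncvx v w (assignB v σ) := by
  have column : ∀ j, (∑ i, w i * assignB v σ i j) * Real.log (∑ i, w i * assignB v σ i j)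
      = ∑ i, (w i * Real.log (w i) * assignB v σ i j
        + w i * assignB v σ i j * Real.log (∑ i', assignB v σ i' j)) := by
    intro j
    rw [Finset.sum_add_distrib, ← Finset.sum_mul, sum_mul_assignB_column v σ w,
      sum_mul_assignB_column v σ (fun i => w i * Real.log (w i)), sum_assignB_column]
    by_cases h0 : assignB v σ (σ j) j = 0
    · simp [h0]
    · rw [Real.log_mul (hw _).ne' h0]
      ring
  have rows : ∑ i, ∑ j, w i * Real.log (w i) * assignB v σ i j = ∑ i, w i * Real.log (w i) :=
    Finset.sum_congr rfl fun i _ => by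
      rw [← Finset.mul_sum, sum_assignB_row v σ i (hσ i), mul_one]
  unfold fcvx fncvx
  rw [Finset.sum_congr rfl fun j _ => column j,
    Finset.sum_comm (s := (Finset.univ : Finset G)) (t := (Finset.univ : Finset A))]
  simp only [Finset.sum_add_distrib]
  rw [rows]
  ring

lemma Feasible.le_column {A G : Type*} [Fintype A] [Fintype G] {b : A → G → ℝ}
    (hb : Feasible b) (i : A) (j : G) : b i j ≤ ∑ i', b i' j :=
  Finset.single_le_sum (fun k _ => hb.1 k j) (Finset.mem_univ i)

lemma Feasible.sum_mul_log_le {A G : Type*} [Fintype A] [Fintype G]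
    {b : A → G → ℝ} (hb : Feasible b) (v : A → G → ℝ) (w : A → ℝ) (hw : ∀ i, 0 < w i) :
    ∑ i, ∑ j, w i * b i j * Real.log (v i j) ≤ ∑ i, ∑ j, w i * |Real.log (v i j)| := by
  refine Finset.sum_le_sum fun i _ => Finset.sum_le_sum fun j _ => ?_
  have hle : b i j ≤ 1 := (hb.le_column i j).trans (hb.2.2 j)
  calc w i * b i j * Real.log (v i j) ≤ w i * b i j * |Real.log (v i j)| :=
        mul_le_mul_of_nonneg_left (le_abs_self _) (mul_nonneg (hw i).le (hb.1 i j))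
    _ ≤ w i * |Real.log (v i j)| :=
        mul_le_mul_of_nonneg_right (mul_le_of_le_one_right (hw i).le hle) (abs_nonneg _)

lemma neg_one_le_mul_log {x : ℝ} (hx : 0 ≤ x) : -1 ≤ x * Real.log x := by
  linarith [Real.self_sub_one_le_mul_log hx]

lemma bddAbove_fcvx {A G : Type*} [Fintype A] [Fintype G]
    (v : A → G → ℝ) (w : A → ℝ) (hw : ∀ i, 0 < w i) :
    BddAbove {z : ℝ | ∃ b, Feasible b ∧ z = fcvx v w b} := by
  refine ⟨(∑ i, ∑ j, w i * |Real.log (v i j)|) - ∑ _j : G, (-1 : ℝ)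
    + ∑ i, w i * Real.log (w i), ?_⟩
  rintro z ⟨b, hb, rfl⟩
  unfold fcvx
  gcongr ?_ - ?_ + _
  · exact hb.sum_mul_log_le v w hw
  · exact Finset.sum_le_sum fun j _ => neg_one_le_mul_log
      (Finset.sum_nonneg fun i _ => mul_nonneg (hw i).le (hb.1 i j))

lemma bddAbove_fncvx {A G : Type*} [Fintype A] [Fintype G]
    (v : A → G → ℝ) (w : A → ℝ) (hw : ∀ i, 0 < w i) :
    BddAbove {z : ℝ | ∃ b, Feasible b ∧ z = fncvx v w b} := by
  refine ⟨(∑ i, ∑ j, w i * |Real.log (v i j)|) - ∑ i, ∑ _j : G, w i * (-1), ?_⟩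
  rintro z ⟨b, hb, rfl⟩
  unfold fncvx
  refine sub_le_sub (hb.sum_mul_log_le v w hw)
    (Finset.sum_le_sum fun i _ => Finset.sum_le_sum fun j _ => ?_)
  have q_nonneg : 0 ≤ ∑ i', b i' j := Finset.sum_nonneg fun k _ => hb.1 k j
  rw [mul_assoc]
  refine mul_le_mul_of_nonneg_left ((neg_one_le_mul_log q_nonneg).trans ?_) (hw i).le
  exact mul_le_mul_of_nonpos_right (hb.le_column i j)
    (Real.log_nonpos q_nonneg (hb.2.2 j))

/-- For an assignment `σ` with `V_i = Σ_{j∈σ⁻¹(i)} v_{ij} > 0` for every agent,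
the point `b` with `b_{ij} = v_{ij}/V_i` if `σ(j) = i` (else `0`) is feasible and satisfies
`f_cvx(b) = f_ncvx(b) = NSW(σ)`.  Consequently both CVX-Weighted and NCVX-Weighted are
relaxations: their suprema over `P(𝒜,𝒢)` are at least `OPT`. -/
theorem programs_are_relaxations
    (A G : Type*) [Fintype A] [Fintype G] [DecidableEq A]
    (v : A → G → ℝ) (w : A → ℝ)
    (hv : ∀ i j, 0 ≤ v i j) (hw : ∀ i, 0 < w i) (hws : ∑ i, w i = 1)
    (σ : G → A)
    (hσ : ∀ i, 0 < ∑ j ∈ Finset.univ.filter (fun j => σ j = i), v i j) :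
    (Feasible (assignB v σ) ∧
      fcvx v w (assignB v σ) = NSW v w σ ∧
      fncvx v w (assignB v σ) = NSW v w σ) ∧
    (∀ τ : G → A, (∀ i, 0 < ∑ j ∈ Finset.univ.filter (fun j => τ j = i), v i j) →
      NSW v w τ ≤ sSup {z : ℝ | ∃ b, Feasible b ∧ z = fcvx v w b} ∧
      NSW v w τ ≤ sSup {z : ℝ | ∃ b, Feasible b ∧ z = fncvx v w b}) := by
  have value_ncvx := fncvx_assignB v w
  have value_cvx : ∀ τ : G → A,
      (∀ i, 0 < ∑ j ∈ Finset.univ.filter (fun j => τ j = i), v i j) →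
      fcvx v w (assignB v τ) = NSW v w τ :=
    fun τ hτ => (fcvx_assignB v w hw τ hτ).trans (value_ncvx τ hτ)
  refine ⟨⟨assignB_feasible v hv σ hσ, value_cvx σ hσ, value_ncvx σ hσ⟩, fun τ hτ => ⟨?_, ?_⟩⟩
  · exact le_csSup (bddAbove_fcvx v w hw)
      ⟨_, assignB_feasible v hv τ hτ, (value_cvx τ hτ).symm⟩
  · exact le_csSup (bddAbove_fncvx v w hw)
      ⟨_, assignB_feasible v hv τ hτ, (value_ncvx τ hτ).symm⟩
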